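/- For every continuous basic cover S, the Lawson topology L(S) — the formal topology presented by the geometric theory T_L — is a compact regular formal topology. -/

import Mathlib

noncomputable section
open Classical

universe u v

namespace FTP

/-! ### Basic covers -/

/-- `U ◁ V` : every element of `U` is covered by `V`. -/
def covS {S : Type*} (cov : S → Set S → Prop) (U V : Set S) : Prop :=
  ∀ a ∈ U, cov a V

/-- A basic cover: reflexivity and transitivity. -/
def IsBasicCover {S : Type*} (cov : S → Set S → Prop) : Prop :=
  (∀ (a : S) (U : Set S), a ∈ U → cov a U) ∧
  (∀ (a : S) (U V : Set S), cov a U → covS cov U V → cov a V)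

/-- the way-below relation `a ≪ b`. -/
def wb {S : Type*} (cov : S → Set S → Prop) (a b : S) : Prop :=
  ∀ U : Set S, cov b U → ∃ U₀ : Finset S, ↑U₀ ⊆ U ∧ cov a ↑U₀

/-- the way-below relation between subsets `U ≪ V`. -/
def wbS {S : Type*} (cov : S → Set S → Prop) (U V : Set S) : Prop :=
  ∀ W : Set S, covS cov V W → ∃ W₀ : Finset S, ↑W₀ ⊆ W ∧ covS cov U ↑W₀

/-- A continuous basic cover, with the witnessing function `w`. -/
def IsContinuous {S : Type*} (cov : S → Set S → Prop) (w : S → Set S) : Prop :=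
  (∀ a : S, ∀ b ∈ w a, wb cov b a) ∧ (∀ a : S, cov a (w a))

/-- splitting subsets. -/
def Splitting {S : Type*} (cov : S → Set S → Prop) (V : Set S) : Prop :=
  ∀ (a : S) (U : Set S), a ∈ V → cov a U → (V ∩ U).Nonempty

/-- located subsets. -/
def Located {S : Type*} (cov : S → Set S → Prop) (V : Set S) : Prop :=
  Splitting cov V ∧ ∀ a b : S, wb cov a b → a ∉ V ∨ b ∈ V

/-- inverse image of a relation. -/
def rinv {α β : Type*} (r : α → β → Prop) (U : Set β) : Set α :=
  {x | ∃ a ∈ U, r x a}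

/-- basic cover maps. -/
def IsBCM {α β : Type*} (cov : α → Set α → Prop) (cov' : β → Set β → Prop)
    (r : α → β → Prop) : Prop :=
  ∀ (a : β) (U : Set β), cov' a U → covS cov (rinv r {a}) (rinv r U)

/-- perfect maps. -/
def IsPerfect {α β : Type*} (cov : α → Set α → Prop) (cov' : β → Set β → Prop)
    (r : α → β → Prop) : Prop :=
  ∀ a b : β, wb cov' a b → wbS cov (rinv r {a}) (rinv r {b})

/-- the terminal basic cover `1 = ({∗}, ∈)`. -/
def unitCov : Unit → Set Unit → Prop := fun x U => x ∈ U

/-! ### Formal topologies -/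

/-- `U ↓ V` with respect to a preorder `le`. -/
def down {S : Type*} (le : S → S → Prop) (U V : Set S) : Set S :=
  {c | ∃ a ∈ U, ∃ b ∈ V, le c a ∧ le c b}

/-- A formal topology: a basic cover together with a compatible preorder. -/
def IsFormalTopology {S : Type*} (cov : S → Set S → Prop) (le : S → S → Prop) : Prop :=
  IsBasicCover cov ∧ Reflexive le ∧ Transitive le ∧
  (∀ a b : S, le a b → cov a {b}) ∧
  (∀ (a : S) (U V : Set S), cov a U → cov a V → cov a (down le U V))

/-- formal topology maps. -/
def IsFTM {α β : Type*} (cov : α → Set α → Prop) (le : α → α → Prop)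
    (cov' : β → Set β → Prop) (le' : β → β → Prop) (r : α → β → Prop) : Prop :=
  IsBCM cov cov' r ∧
  covS cov Set.univ (rinv r Set.univ) ∧
  ∀ a b : β, covS cov (down le (rinv r {a}) (rinv r {b})) (rinv r (down le' {a} {b}))

/-- the order on maps. -/
def MapLE {α β : Type*} (cov : α → Set α → Prop) (r s : α → β → Prop) : Prop :=
  ∀ a : β, covS cov (rinv r {a}) (rinv s {a})

/-- equality of maps. -/
def MapEq {α β : Type*} (cov : α → Set α → Prop) (r s : α → β → Prop) : Prop :=
  MapLE cov r s ∧ MapLE cov s r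

/-- composition of relational maps (`comp s r = s ∘ r`). -/
def comp {α β γ : Type*} (s : β → γ → Prop) (r : α → β → Prop) : α → γ → Prop :=
  fun x c => ∃ b, r x b ∧ s b c

/-- `b* = {c | c ↓ b ◁ ∅}`. -/
def star {S : Type*} (cov : S → Set S → Prop) (le : S → S → Prop) (b : S) : Set S :=
  {c | covS cov (down le {c} {b}) ∅}

/-- `b ⋘ a` iff `S ◁ b* ∪ {a}`. -/
def wc {S : Type*} (cov : S → Set S → Prop) (le : S → S → Prop) (b a : S) : Prop :=
  covS cov Set.univ (star cov le b ∪ {a})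

/-- regular formal topologies. -/
def Regular {S : Type*} (cov : S → Set S → Prop) (le : S → S → Prop) : Prop :=
  ∀ a : S, cov a {b | wc cov le b a}

/-- compactness: `S ≪ S`. -/
def Compact {S : Type*} (cov : S → Set S → Prop) : Prop :=
  wbS cov Set.univ Set.univ

/-- stability: `a ≪ a'` and `b ≪ b'` imply `a↓b ≪ a'↓b'`. -/
def Stable {S : Type*} (cov : S → Set S → Prop) (le : S → S → Prop) : Prop :=
  ∀ a a' b b' : S, wb cov a a' → wb cov b b' →
    wbS cov (down le {a} {b}) (down le {a'} {b'})

/-- isomorphism of formal topologies. -/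
def IsIso {α β : Type*} (cov : α → Set α → Prop) (le : α → α → Prop)
    (cov' : β → Set β → Prop) (le' : β → β → Prop) : Prop :=
  ∃ (r : α → β → Prop) (s : β → α → Prop),
    IsFTM cov le cov' le' r ∧ IsFTM cov' le' cov le s ∧
    MapEq cov (comp s r) (fun a b => a = b) ∧
    MapEq cov' (comp r s) (fun a b => a = b)

/-! ### Geometric theories and the covers they present -/

/-- the preorder `A ≤ B ↔ B ⊆ A` on finite sets of generators. -/
def supord {P : Type*} : Finset P → Finset P → Prop := fun A B => B ⊆ A

/-- The cover on `Finset P` inductively generated by a geometric theory `T`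
(an axiom `T A 𝒞` means `⋀A ⊢ ⋁_{B ∈ 𝒞} ⋀B`). -/
inductive GCov {P : Type*} (T : Finset P → Set (Finset P) → Prop) :
    Finset P → Set (Finset P) → Prop where
  | refl {A : Finset P} {𝒰 : Set (Finset P)} : A ∈ 𝒰 → GCov T A 𝒰
  | le {A B : Finset P} {𝒰 : Set (Finset P)} : B ⊆ A → GCov T B 𝒰 → GCov T A 𝒰
  | ax {A : Finset P} {𝒞 𝒰 : Set (Finset P)} (C : Finset P) :
      T A 𝒞 → (∀ B ∈ 𝒞, GCov T (C ∪ B) 𝒰) → GCov T (C ∪ A) 𝒰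

theorem GCov_trans {P : Type*} {T : Finset P → Set (Finset P) → Prop}
    {A : Finset P} {𝒰 𝒱 : Set (Finset P)}
    (h : GCov T A 𝒰) (h' : ∀ B ∈ 𝒰, GCov T B 𝒱) : GCov T A 𝒱 := by
  induction h with
  | refl hA => exact h' _ hA
  | le hBA _ ih => exact GCov.le hBA (ih h')
  | ax C hT _ ih => exact GCov.ax C hT (fun B hB => ih B hB h')

theorem GCov_isBasicCover {P : Type*} (T : Finset P → Set (Finset P) → Prop) :
    IsBasicCover (GCov T) :=
  ⟨fun _ _ h => GCov.refl h, fun _ _ _ h h' => GCov_trans h h'⟩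

/-! ### The patch, Lawson and lower powerlocale theories -/

/-- generators of the patch/Lawson theories : `r a` and `l A`. -/
inductive PatchGen (S : Type u) : Type u where
  | r : S → PatchGen S
  | l : Finset S → PatchGen S

/-- The geometric theory `T_P` presenting the patch of a stably locally compact
formal topology. -/
inductive PatchThy {S : Type*} (cov : S → Set S → Prop) (le : S → S → Prop) :
    Finset (PatchGen S) → Set (Finset (PatchGen S)) → Prop where
  | R1 : PatchThy cov le ∅ {B | ∃ a : S, B = {PatchGen.r a}}
  | R2 (a b : S) :
      PatchThy cov le {PatchGen.r a, PatchGen.r b}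
        {B | ∃ c ∈ down le {a} {b}, B = {PatchGen.r c}}
  | R3 (a : S) (A : Finset S) :
      cov a ↑A → PatchThy cov le {PatchGen.r a} {B | ∃ b ∈ A, B = {PatchGen.r b}}
  | R4 (a : S) :
      PatchThy cov le {PatchGen.r a} {B | ∃ b : S, wb cov b a ∧ B = {PatchGen.r b}}
  | L1 : PatchThy cov le ∅ {({PatchGen.l ∅} : Finset (PatchGen S))}
  | L2 (A B : Finset S) :
      covS cov ↑A ↑B →
      PatchThy cov le {PatchGen.l B} {({PatchGen.l A} : Finset (PatchGen S))}
  | L3 (A B : Finset S) :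
      PatchThy cov le {PatchGen.l A, PatchGen.l B}
        {D | ∃ C : Finset S, wbS cov ↑A ↑C ∧ wbS cov ↑B ↑C ∧ D = {PatchGen.l C}}
  | Loc (a b : S) :
      wb cov a b →
      PatchThy cov le ∅
        {({PatchGen.l {a}} : Finset (PatchGen S)), ({PatchGen.r b} : Finset (PatchGen S))}
  | D (a : S) :
      PatchThy cov le {PatchGen.l {a}, PatchGen.r a} (∅ : Set (Finset (PatchGen S)))

/-- the cover of `Patch(S)`. -/
def patchCov {S : Type*} (cov : S → Set S → Prop) (le : S → S → Prop) :
    Finset (PatchGen S) → Set (Finset (PatchGen S)) → Prop :=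
  GCov (PatchThy cov le)

/-- the counit `ε_P : Patch(S) → S`. -/
def epsP {S : Type*} (cov : S → Set S → Prop) (le : S → S → Prop) :
    Finset (PatchGen S) → S → Prop :=
  fun 𝔄 a => patchCov cov le 𝔄 {({PatchGen.r a} : Finset (PatchGen S))}

/-- The geometric theory `T_L` presenting the Lawson topology of a continuous
basic cover (the axioms of `T_P` without (R1), (R2)). -/
inductive LawsonThy {S : Type*} (cov : S → Set S → Prop) :
    Finset (PatchGen S) → Set (Finset (PatchGen S)) → Prop where
  | R3 (a : S) (A : Finset S) :
      cov a ↑A → LawsonThy cov {PatchGen.r a} {B | ∃ b ∈ A, B = {PatchGen.r b}}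
  | R4 (a : S) :
      LawsonThy cov {PatchGen.r a} {B | ∃ b : S, wb cov b a ∧ B = {PatchGen.r b}}
  | L1 : LawsonThy cov ∅ {({PatchGen.l ∅} : Finset (PatchGen S))}
  | L2 (A B : Finset S) :
      covS cov ↑A ↑B →
      LawsonThy cov {PatchGen.l B} {({PatchGen.l A} : Finset (PatchGen S))}
  | L3 (A B : Finset S) :
      LawsonThy cov {PatchGen.l A, PatchGen.l B}
        {D | ∃ C : Finset S, wbS cov ↑A ↑C ∧ wbS cov ↑B ↑C ∧ D = {PatchGen.l C}}
  | Loc (a b : S) :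
      wb cov a b →
      LawsonThy cov ∅
        {({PatchGen.l {a}} : Finset (PatchGen S)), ({PatchGen.r b} : Finset (PatchGen S))}
  | D (a : S) :
      LawsonThy cov {PatchGen.l {a}, PatchGen.r a} (∅ : Set (Finset (PatchGen S)))

/-- the cover of the Lawson topology `L(S)`. -/
def lawsonCov {S : Type*} (cov : S → Set S → Prop) :
    Finset (PatchGen S) → Set (Finset (PatchGen S)) → Prop :=
  GCov (LawsonThy cov)

/-- the counit `ε_L : L(S) → S`. -/
def epsL {S : Type*} (cov : S → Set S → Prop) : Finset (PatchGen S) → S → Prop :=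
  fun 𝔄 a => lawsonCov cov 𝔄 {({PatchGen.r a} : Finset (PatchGen S))}

/-- The theory presenting the lower powerlocale of a continuous basic cover:
generators `a ∈ S`, axioms (R3) and (R4). -/
inductive LowerThy {S : Type*} (cov : S → Set S → Prop) :
    Finset S → Set (Finset S) → Prop where
  | R3 (a : S) (A : Finset S) :
      cov a ↑A → LowerThy cov {a} {B | ∃ b ∈ A, B = ({b} : Finset S)}
  | R4 (a : S) :
      LowerThy cov {a} {B | ∃ b : S, wb cov b a ∧ B = ({b} : Finset S)}

/-- the cover of the lower powerlocale `Lower(S)`. -/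
def lowerCov {S : Type*} (cov : S → Set S → Prop) :
    Finset S → Set (Finset S) → Prop :=
  GCov (LowerThy cov)

/-- the counit `σ_L : Lower(S) → S`. -/
def sigmaL {S : Type*} (cov : S → Set S → Prop) : Finset S → S → Prop :=
  fun A a => lowerCov cov A ({({a} : Finset S)} : Set (Finset S))

/-! ### de Groot duals -/

/-- `↟A = {B ∈ Fin S | A ≪ B}`. -/
def upF {S : Type*} (cov : S → Set S → Prop) (A : Finset S) : Set (Finset S) :=
  {B | wbS cov ↑A ↑B}

/-- the finite join `⋁^F {↟A | A ∈ 𝒜}` of Scott open filters. -/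
def finJoin {S : Type*} (cov : S → Set S → Prop) (le : S → S → Prop)
    (𝒜 : Finset (Finset S)) : Set (Finset S) :=
  if 𝒜 = ∅ then {B | covS cov Set.univ ↑B}
  else {B | ∃ g : Finset S → Finset S,
    (∀ A ∈ 𝒜, wbS cov ↑A ↑(g A)) ∧
    wbS cov {c | ∀ A ∈ 𝒜, ∃ b ∈ g A, le c b} ↑B}

/-- The cover `◁^D` of the de Groot dual `S^D`, inductively generated on
`(Fin S, ⊇)` by the axioms (D3) `A ◁ ↟A` and (D4). -/
inductive DCov {S : Type*} (cov : S → Set S → Prop) (le : S → S → Prop) :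
    Finset S → Set (Finset S) → Prop where
  | refl {A : Finset S} {𝒰 : Set (Finset S)} : A ∈ 𝒰 → DCov cov le A 𝒰
  | le {A B : Finset S} {𝒰 : Set (Finset S)} :
      B ⊆ A → DCov cov le B 𝒰 → DCov cov le A 𝒰
  | d3 {A A' : Finset S} {𝒰 : Set (Finset S)} :
      A ⊆ A' →
      (∀ C : Finset S, A' ⊆ C → (∃ B : Finset S, wbS cov ↑A ↑B ∧ B ⊆ C) →
        DCov cov le C 𝒰) →
      DCov cov le A' 𝒰
  | d4 {A A' : Finset S} {𝒜 : Finset (Finset S)} {𝒰 : Set (Finset S)} :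
      A ⊆ A' → upF cov A ⊆ finJoin cov le 𝒜 →
      (∀ C : Finset S, A' ⊆ C → (∃ B ∈ 𝒜, B ⊆ C) → DCov cov le C 𝒰) →
      DCov cov le A' 𝒰

/-- the cover of the Scott topology `Σ(S)` on `(Fin S, ⊇)`. -/
def scottCov {S : Type*} (cov : S → Set S → Prop) :
    Finset S → Set (Finset S) → Prop :=
  fun A 𝒰 => upF cov A ⊆ ⋃ B ∈ 𝒰, upF cov B

/-- a filter (with respect to `◁`) of basic opens, given by a set of finite subsets. -/
def IsCovFilter {S : Type*} (cov : S → Set S → Prop) (le : S → S → Prop)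
    (𝒱 : Set (Finset S)) : Prop :=
  𝒱.Nonempty ∧
  (∀ A ∈ 𝒱, ∀ B : Finset S, covS cov ↑A ↑B → B ∈ 𝒱) ∧
  (∀ A ∈ 𝒱, ∀ B ∈ 𝒱, ∃ C ∈ 𝒱, covS cov ↑C (down le ↑A ↑B))

/-- The geometric theory `T^d` presenting the de Groot dual `S^d`:
generators `l A` (identified with `A : Finset S`), axioms (L1)–(L3) and (D4). -/
inductive DGThy {S : Type*} (cov : S → Set S → Prop) (le : S → S → Prop) :
    Finset (Finset S) → Set (Finset (Finset S)) → Prop where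
  | L1 : DGThy cov le ∅ {({(∅ : Finset S)} : Finset (Finset S))}
  | L2 (A B : Finset S) :
      covS cov ↑A ↑B → DGThy cov le {B} {({A} : Finset (Finset S))}
  | L3 (A B : Finset S) :
      DGThy cov le {A, B}
        {D | ∃ C : Finset S, wbS cov ↑A ↑C ∧ wbS cov ↑B ↑C ∧ D = ({C} : Finset (Finset S))}
  | D4 (A : Finset S) (𝒜 : Finset (Finset S)) :
      upF cov A ⊆ finJoin cov le 𝒜 →
      DGThy cov le {A} {D | ∃ B ∈ 𝒜, D = ({B} : Finset (Finset S))}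

/-! ### Spectral formal topologies -/

/-- spectral formal topologies: a compatible meet-semilattice structure on the
base, with every basic element way-below itself. -/
def IsSpectral {S : Type*} (cov : S → Set S → Prop) (le : S → S → Prop)
    (one : S) (meet : S → S → S) : Prop :=
  (∀ a : S, cov a {one}) ∧
  (∀ a b : S, cov (meet a b) (down le {a} {b})) ∧
  (∀ a b : S, ∀ c ∈ down le {a} {b}, cov c {meet a b}) ∧
  (∀ a : S, wb cov a a)

/-! ### Subtopologies -/

/-- the property of being a formal-topology cover compatible with `le`. -/
def IsFTCover {S : Type*} (cov : S → Set S → Prop) (le : S → S → Prop) : Prop :=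
  IsBasicCover cov ∧ (∀ a b : S, le a b → cov a {b}) ∧
  (∀ (a : S) (U V : Set S), cov a U → cov a V → cov a (down le U V))

/-- The meet (in `SubTop(S)`) of a family of subtopology covers: the least
formal-topology cover containing all of them. -/
def covMeet {S : Type*} {ι : Sort*} (le : S → S → Prop)
    (F : ι → (S → Set S → Prop)) : S → Set S → Prop :=
  fun a U => ∀ c : S → Set S → Prop,
    IsFTCover c le → (∀ i : ι, ∀ (a' : S) (U' : Set S), F i a' U' → c a' U') → c a U

/-- the closed subtopology `C_a` determined by `{a}`. -/
def closedCov {S : Type*} (cov : S → Set S → Prop) (a : S) : S → Set S → Prop :=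
  fun c V => cov c ({a} ∪ V)

/-- the open subtopology `S_B` determined by a finite `B`. -/
def openCov {S : Type*} (cov : S → Set S → Prop) (le : S → S → Prop)
    (B : Finset S) : S → Set S → Prop :=
  fun c V => covS cov (down le {c} ↑B) V

/-- `K_A = ⋀_{A ≪ B} S_B`. -/
def KCov {S : Type*} (cov : S → Set S → Prop) (le : S → S → Prop) (A : Finset S) :
    S → Set S → Prop :=
  covMeet le (fun B : {B : Finset S // wbS cov ↑A ↑B} => openCov cov le B.1)

/-- `C_a ∨ K_A` (the join of subtopologies is the intersection of covers). -/
def CKCov {S : Type*} (cov : S → Set S → Prop) (le : S → S → Prop)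
    (a : S) (A : Finset S) : S → Set S → Prop :=
  fun c V => closedCov cov a c V ∧ KCov cov le A c V

/-- perfect subtopologies. -/
def IsPerfectSub {S : Type*} (cov : S → Set S → Prop) (le : S → S → Prop)
    (cov' : S → Set S → Prop) : Prop :=
  IsFTCover cov' le ∧ (∀ (a : S) (U : Set S), cov a U → cov' a U) ∧
  (∀ a b : S, wb cov a b → wb cov' a b)

/-- the order of `PSub(S)`: `(a,A) ≤ (b,B)` iff `C_b ∨ K_B ⊑ C_a ∨ K_A`. -/
def PSubLe {S : Type*} (cov : S → Set S → Prop) (le : S → S → Prop) :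
    S × Finset S → S × Finset S → Prop :=
  fun p q => ∀ (c : S) (V : Set S), CKCov cov le p.1 p.2 c V → CKCov cov le q.1 q.2 c V

/-- the cover of `PSub(S)`: `(a,A) ◁ U` iff `⋀{C_b ∨ K_B | (b,B) ∈ U} ⊑ C_a ∨ K_A`. -/
def covPSub {S : Type*} (cov : S → Set S → Prop) (le : S → S → Prop) :
    S × Finset S → Set (S × Finset S) → Prop :=
  fun p U => ∀ (c : S) (V : Set S), CKCov cov le p.1 p.2 c V →
    covMeet le (fun q : U => CKCov cov le q.1.1 q.1.2) c V

/-- the map `r : PSub(S) → Patch(S)` on generators. -/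
def rGenPS {S : Type*} (cov : S → Set S → Prop) (le : S → S → Prop)
    (p : S × Finset S) : PatchGen S → Prop
  | PatchGen.r b => covPSub cov le p {((b, (∅ : Finset S)) : S × Finset S)}
  | PatchGen.l B => covPSub cov le p {q : S × Finset S | q.2 = B}

/-- the map `r : PSub(S) → Patch(S)`, extended along the presentation. -/
def rPS {S : Type*} (cov : S → Set S → Prop) (le : S → S → Prop) :
    S × Finset S → Finset (PatchGen S) → Prop :=
  fun p 𝔅 => ∀ g ∈ 𝔅, covPSub cov le p (rinv (fun q g' => rGenPS cov le q g') {g})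

/-- the map `s : Patch(S) → PSub(S)`. -/
def sPS {S : Type*} (cov : S → Set S → Prop) (le : S → S → Prop) :
    Finset (PatchGen S) → (S × Finset S) → Prop :=
  fun 𝔄 p => patchCov cov le 𝔄
    ({({PatchGen.r p.1, PatchGen.l p.2} : Finset (PatchGen S))} : Set (Finset (PatchGen S)))

/-! ### Saturated subsets, dcpos and preframes -/

/-- the saturated subsets of a basic cover. -/
abbrev SatSet {α : Type*} (cov : α → Set α → Prop) : Type _ :=
  {U : Set α // ∀ a, cov a U → a ∈ U}

/-- the join of a family of saturated subsets. -/
def satSup {α : Type*} {cov : α → Set α → Prop} (hbc : IsBasicCover cov)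
    (D : Set (SatSet cov)) : SatSet cov :=
  ⟨{a | cov a (⋃ U ∈ D, (U : Set α))}, fun a h => hbc.2 a _ _ h (fun _ hb => hb)⟩

/-- inductively generated basic covers: `BGen Ax` is the cover generated by the
axiom-set with axioms `a ◁ C` for `C ∈ Ax a`. -/
inductive BGen {S : Type*} (Ax : S → Set (Set S)) : S → Set S → Prop where
  | refl {a : S} {U : Set S} : a ∈ U → BGen Ax a U
  | infty {a : S} {U : Set S} (C : Set S) :
      C ∈ Ax a → (∀ b ∈ C, BGen Ax b U) → BGen Ax a U

theorem BGen_trans {S : Type*} {Ax : S → Set (Set S)} {a : S} {U V : Set S}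
    (h : BGen Ax a U) (h' : ∀ b ∈ U, BGen Ax b V) : BGen Ax a V := by
  induction h with
  | refl ha => exact h' _ ha
  | infty C hC _ ih => exact BGen.infty C hC (fun b hb => ih b hb h')

theorem BGen_isBasicCover {S : Type*} (Ax : S → Set (Set S)) :
    IsBasicCover (BGen Ax) :=
  ⟨fun _ _ h => BGen.refl h, fun _ _ _ h h' => BGen_trans h h'⟩

/-- the lower powerlocale theory of an inductively generated basic cover. -/
inductive LowerThyAx {S : Type*} (Ax : S → Set (Set S)) :
    Finset S → Set (Finset S) → Prop where
  | mk (a : S) (C : Set S) :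
      C ∈ Ax a → LowerThyAx Ax {a} {B | ∃ b ∈ C, B = ({b} : Finset S)}

/-- the counit `σ_L : Lower(S) → S` for an inductively generated basic cover. -/
def sigmaLAx {S : Type*} (Ax : S → Set (Set S)) : Finset S → S → Prop :=
  fun A a => GCov (LowerThyAx Ax) A ({({a} : Finset S)} : Set (Finset S))

/-- the top saturated subset of a presented topology. -/
def satTop {P : Type*} (T : Finset P → Set (Finset P) → Prop) : SatSet (GCov T) :=
  ⟨Set.univ, fun _ _ => Set.mem_univ _⟩

/-- binary meets of saturated subsets of a presented topology. -/
def satInfL {P : Type*} (T : Finset P → Set (Finset P) → Prop)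
    (U V : SatSet (GCov T)) : SatSet (GCov T) :=
  ⟨{A | GCov T A (down supord (U : Set (Finset P)) (V : Set (Finset P)))},
   fun _ h => GCov_trans h (fun _ hB => hB)⟩

/-- the suplattice homomorphism `σ_L* : Sat(S) → Sat(Lower(S))`. -/
def sigmaStar {S : Type*} (Ax : S → Set (Set S)) (U : SatSet (BGen Ax)) :
    SatSet (GCov (LowerThyAx Ax)) :=
  ⟨{A : Finset S | GCov (LowerThyAx Ax) A (rinv (sigmaLAx Ax) (U : Set S))},
   fun _ h => GCov_trans h (fun _ hB => hB)⟩

/-- a preframe structure on a partial order: finite meets and directed joins,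
with finite meets distributing over directed joins. -/
structure PreframeStr (X : Type*) [PartialOrder X] where
  top : X
  inf : X → X → X
  dSup : Set X → X
  le_top : ∀ x, x ≤ top
  inf_le_left : ∀ x y, inf x y ≤ x
  inf_le_right : ∀ x y, inf x y ≤ y
  le_inf : ∀ x y z, x ≤ y → x ≤ z → x ≤ inf y z
  le_dSup : ∀ d : Set X, d.Nonempty → DirectedOn (· ≤ ·) d → ∀ x ∈ d, x ≤ dSup d
  dSup_le : ∀ d : Set X, d.Nonempty → DirectedOn (· ≤ ·) d →
    ∀ z, (∀ x ∈ d, x ≤ z) → dSup d ≤ z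
  distrib : ∀ (x : X) (d : Set X), d.Nonempty → DirectedOn (· ≤ ·) d →
    inf x (dSup d) = dSup ((fun y => inf x y) '' d)

/-- dcpo homomorphisms out of `Sat(S)`. -/
def IsDcpoHom {α : Type*} {cov : α → Set α → Prop} (hbc : IsBasicCover cov)
    {X : Type*} [PartialOrder X] (PF : PreframeStr X) (f : SatSet cov → X) : Prop :=
  Monotone f ∧
  ∀ D : Set (SatSet cov), D.Nonempty → DirectedOn (· ≤ ·) D →
    f (satSup hbc D) = PF.dSup (f '' D)

/-- preframe homomorphisms out of the frame of a presented topology. -/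
def IsPreframeHomL {P : Type*} (T : Finset P → Set (Finset P) → Prop)
    {X : Type*} [PartialOrder X] (PF : PreframeStr X)
    (F : SatSet (GCov T) → X) : Prop :=
  Monotone F ∧ F (satTop T) = PF.top ∧
  (∀ U V, F (satInfL T U V) = PF.inf (F U) (F V)) ∧
  ∀ D : Set (SatSet (GCov T)), D.Nonempty → DirectedOn (· ≤ ·) D →
    F (satSup (GCov_isBasicCover T) D) = PF.dSup (F '' D)

/-! ### Located subsets: auxiliary notions -/

/-- the lower part `L_V` associated to a located subset `V`. -/
def LV {S : Type*} (cov : S → Set S → Prop) (V : Set S) : Set S :=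
  {a | ∃ A : Finset S, wbS cov {a} ↑A ∧ (↑A ∩ V : Set S) = ∅}

/-- cuts of a continuous basic cover. -/
def IsCut {S : Type*} (cov : S → Set S → Prop) (L U : Set S) : Prop :=
  (∀ (a : S) (A : Finset S), cov a ↑A → a ∈ U → ((↑A : Set S) ∩ U).Nonempty) ∧
  (∀ a ∈ U, ∃ b : S, wb cov b a ∧ b ∈ U) ∧
  (∀ (a : S) (A : Finset S), cov a ↑A → (↑A : Set S) ⊆ L → a ∈ L) ∧
  (∀ a ∈ L, ∃ A : Finset S, wbS cov {a} ↑A ∧ (↑A : Set S) ⊆ L) ∧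
  (∀ a b : S, wb cov a b → a ∈ L ∨ b ∈ U) ∧
  L ∩ U = ∅

end FTP

namespace FTP

/-! ### The way-below relation on subsets -/

section WayBelow

variable {S : Type*} {cov : S → Set S → Prop}

theorem covS_of_subset (hbc : IsBasicCover cov) {U V : Set S} (h : U ⊆ V) : covS cov U V :=
  fun a ha => hbc.1 a V (h ha)

theorem covS_trans (hbc : IsBasicCover cov) {U V W : Set S} (h : covS cov U V)
    (h' : covS cov V W) : covS cov U W :=
  fun a ha => hbc.2 a V W (h a ha) h'

theorem wbS_of_covS_of_wbS (hbc : IsBasicCover cov) {U U' V : Set S} (h : covS cov U U')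
    (h' : wbS cov U' V) : wbS cov U V := by
  intro W hW
  obtain ⟨W₀, hW₀, hU⟩ := h' W hW
  exact ⟨W₀, hW₀, covS_trans hbc h hU⟩

theorem wbS_of_wbS_of_covS (hbc : IsBasicCover cov) {U V V' : Set S} (h : wbS cov U V)
    (h' : covS cov V V') : wbS cov U V' :=
  fun W hW => h W (covS_trans hbc h' hW)

theorem covS_of_wbS (hbc : IsBasicCover cov) {U V : Set S} (h : wbS cov U V) : covS cov U V := by
  obtain ⟨W₀, hW₀, hU⟩ := h V (covS_of_subset hbc subset_rfl)
  exact covS_trans hbc hU (covS_of_subset hbc hW₀)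

theorem wbS_singleton {a b : S} (h : wb cov a b) : wbS cov {a} {b} := by
  intro W hW
  obtain ⟨W₀, hW₀, ha⟩ := h W (hW b rfl)
  exact ⟨W₀, hW₀, by rintro _ rfl; exact ha⟩

theorem wbS_finset (hbc : IsBasicCover cov) {V : Set S} (F : Finset S)
    (h : ∀ f ∈ F, ∃ v ∈ V, wb cov f v) : wbS cov ↑F V := by
  intro W hW
  induction F using Finset.induction_on with
  | empty => exact ⟨∅, by simp, fun a ha => by simp at ha⟩
  | insert f F _ ih =>
    obtain ⟨W₁, hW₁, hF⟩ := ih fun g hg => h g (Finset.mem_insert_of_mem hg)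
    obtain ⟨v, hv, hfv⟩ := h f (Finset.mem_insert_self f F)
    obtain ⟨W₂, hW₂, hf⟩ := hfv W (hW v hv)
    refine ⟨W₁ ∪ W₂, by simp [hW₁, hW₂], fun a ha => ?_⟩
    rcases Finset.mem_insert.1 (Finset.mem_coe.1 ha) with rfl | ha
    · exact hbc.2 _ _ _ hf (covS_of_subset hbc (by simp))
    · exact hbc.2 _ _ _ (hF a ha) (covS_of_subset hbc (by simp))

theorem exists_finset_interpolant (hbc : IsBasicCover cov) {w : S → Set S}
    (hw : IsContinuous cov w) {U V : Set S} (h : wbS cov U V) :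
    ∃ F : Finset S, wbS cov U ↑F ∧ ∀ f ∈ F, ∃ v ∈ V, wb cov f v := by
  obtain ⟨G, hG, hUG⟩ := h {g | ∃ f, (∃ v ∈ V, wb cov f v) ∧ wb cov g f} fun v hv =>
    hbc.2 _ _ _ (hw.2 v) fun f hf =>
      hbc.2 _ _ _ (hw.2 f) fun g hg => hbc.1 _ _ ⟨f, ⟨v, hv, hw.1 v f hf⟩, hw.1 f g hg⟩
  choose φ hφ hgφ using fun g : G => hG g.2
  refine ⟨Finset.univ.image φ, wbS_of_covS_of_wbS hbc hUG (wbS_finset hbc G fun g hg =>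
    ⟨φ ⟨g, hg⟩, by simp, hgφ ⟨g, hg⟩⟩), ?_⟩
  intro f hf
  obtain ⟨g, _, rfl⟩ := Finset.mem_image.1 hf
  exact hφ g

end WayBelow

/-! ### Derivations in geometric theories -/

section GCov

variable {P : Type*} {T : Finset P → Set (Finset P) → Prop}

theorem GCov_mono {A : Finset P} {𝒰 𝒱 : Set (Finset P)} (h : GCov T A 𝒰) (h' : 𝒰 ⊆ 𝒱) :
    GCov T A 𝒱 :=
  GCov_trans h fun _ hB => GCov.refl (h' hB)

theorem GCov_of_superset {A B : Finset P} {𝒰 : Set (Finset P)} (hB : B ∈ 𝒰) (h : B ⊆ A) :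
    GCov T A 𝒰 :=
  GCov.le h (GCov.refl hB)

theorem GCov_union_left {A : Finset P} {𝒰 : Set (Finset P)} (C : Finset P) (h : GCov T A 𝒰) :
    GCov T (C ∪ A) {D | ∃ B ∈ 𝒰, D = C ∪ B} := by
  induction h with
  | refl hA => exact GCov.refl ⟨_, hA, rfl⟩
  | le hBA _ ih => exact GCov.le (Finset.union_subset_union_right hBA) ih
  | ax E hT _ ih =>
    rw [← Finset.union_assoc]
    refine GCov.ax (C ∪ E) hT fun B hB => ?_
    rw [Finset.union_assoc]
    exact ih B hB

theorem GCov_cut {A X : Finset P} {𝒰 𝒱 : Set (Finset P)} (h : GCov T A 𝒰) (hA : A ⊆ X)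
    (h' : ∀ B ∈ 𝒰, GCov T (X ∪ B) 𝒱) : GCov T X 𝒱 := by
  have hX := GCov_union_left X h
  rw [Finset.union_eq_left.2 hA] at hX
  refine GCov_trans hX ?_
  rintro _ ⟨B, hB, rfl⟩
  exact h' B hB

theorem GCov_of_thy {A : Finset P} {𝒞 : Set (Finset P)} (h : T A 𝒞) : GCov T A 𝒞 := by
  have := GCov.ax (𝒰 := 𝒞) ∅ h fun B hB => GCov_of_superset hB (by simp)
  simpa using this

theorem GCov_cut_finset {A X : Finset P} {𝒟 : Finset (Finset P)} {𝒰 : Set (Finset P)}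
    (h : GCov T A ↑𝒟) (hA : A ⊆ X)
    (h' : ∀ D ∈ 𝒟, ∃ 𝒰₀ : Finset (Finset P), ↑𝒰₀ ⊆ 𝒰 ∧ GCov T (X ∪ D) ↑𝒰₀) :
    ∃ 𝒰₀ : Finset (Finset P), ↑𝒰₀ ⊆ 𝒰 ∧ GCov T X ↑𝒰₀ := by
  choose! φ hφ hcov using h'
  refine ⟨𝒟.biUnion φ, by simpa using hφ, GCov_cut h hA fun D hD => ?_⟩
  exact GCov_mono (hcov D hD) (by
    simpa using Set.subset_biUnion_of_mem (u := fun D => (φ D : Set (Finset P))) hD)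

theorem GCov_wc_empty : wc (GCov T) supord ∅ ∅ :=
  fun _ _ => GCov_of_superset (Or.inr rfl) (Finset.empty_subset _)

theorem GCov_star_of_inconsistent {B C : Finset P} (h : GCov T (B ∪ C) ∅) :
    C ∈ star (GCov T) supord B := by
  rintro D ⟨_, rfl, _, rfl, hC, hB⟩
  exact GCov.le (Finset.union_subset hB hC) h

theorem GCov_inconsistent_of_star {B C : Finset P} (h : C ∈ star (GCov T) supord B) :
    GCov T (B ∪ C) ∅ :=
  h _ ⟨C, rfl, B, rfl, Finset.subset_union_right, Finset.subset_union_left⟩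

theorem GCov_wc_of_cover {A B : Finset P} {𝒰 : Set (Finset P)} (h : GCov T ∅ 𝒰)
    (h' : ∀ C ∈ 𝒰, GCov T (B ∪ C) ∅ ∨ GCov T C {A}) : wc (GCov T) supord B A := by
  refine fun X _ => GCov.le (Finset.empty_subset X) (GCov_trans h fun C hC => ?_)
  rcases h' C hC with h | h
  · exact GCov.refl (Or.inl (GCov_star_of_inconsistent h))
  · exact GCov_mono h Set.subset_union_right

theorem GCov_wc_union {A A' B B' : Finset P} (h : wc (GCov T) supord B A)
    (h' : wc (GCov T) supord B' A') : wc (GCov T) supord (B ∪ B') (A ∪ A') := by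
  have hcov : GCov T ∅ {D | ∃ C ∈ star (GCov T) supord B ∪ {A},
      ∃ C' ∈ star (GCov T) supord B' ∪ {A'}, D = C ∪ C'} :=
    GCov_trans (h ∅ trivial) fun C hC =>
      GCov_cut (h' ∅ trivial) (Finset.empty_subset C)
        fun C' hC' => GCov.refl ⟨C, hC, C', hC', rfl⟩
  refine GCov_wc_of_cover hcov ?_
  rintro _ ⟨C, hC | rfl, C', hC' | rfl, rfl⟩
  · exact Or.inl (GCov.le (by grind) (GCov_inconsistent_of_star hC))
  · exact Or.inl (GCov.le (by grind) (GCov_inconsistent_of_star hC))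
  · exact Or.inl (GCov.le (by grind) (GCov_inconsistent_of_star hC'))
  · exact Or.inr (GCov.refl rfl)

/-- Regularity of a presented topology need only be checked on the generators. -/
theorem GCov_regular
    (h : ∀ g : P, GCov T {g} {B | wc (GCov T) supord B {g}}) : Regular (GCov T) supord := by
  intro A
  induction A using Finset.induction_on with
  | empty => exact GCov.refl GCov_wc_empty
  | insert g A _ ih =>
    refine GCov_cut (h g) (by simp) fun B hB => GCov_cut ih (by grind) fun B' hB' => ?_
    refine GCov_of_superset (B := B ∪ B') ?_ (by grind)
    rw [Finset.insert_eq]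
    exact GCov_wc_union hB hB'

end GCov

/-! ### Derivations in the Lawson theory -/

section Lawson

variable {S : Type*} {cov : S → Set S → Prop}

theorem lawsonCov_r_of_cov {a : S} {A : Finset S} (h : cov a ↑A) :
    lawsonCov cov {PatchGen.r a} {B | ∃ b ∈ A, B = {PatchGen.r b}} :=
  GCov_of_thy (LawsonThy.R3 a A h)

theorem lawsonCov_r_of_wb (hbc : IsBasicCover cov) {a b : S} (h : wb cov b a) :
    lawsonCov cov {PatchGen.r b} {{PatchGen.r a}} := by
  have hcov : cov b ↑({a} : Finset S) := by
    simpa using covS_of_wbS hbc (wbS_singleton h) b rfl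
  exact GCov_mono (lawsonCov_r_of_cov hcov) (by simp)

theorem lawsonCov_l_of_covS {A B : Finset S} (h : covS cov ↑A ↑B) :
    lawsonCov cov {PatchGen.l B} {{PatchGen.l A}} :=
  GCov_of_thy (LawsonThy.L2 A B h)

theorem lawsonCov_l_union (hbc : IsBasicCover cov) (A B : Finset S) :
    lawsonCov cov {PatchGen.l A, PatchGen.l B} {{PatchGen.l (A ∪ B)}} := by
  refine GCov_trans (GCov_of_thy (LawsonThy.L3 A B)) ?_
  rintro _ ⟨C, hA, hB, rfl⟩
  refine lawsonCov_l_of_covS fun a ha => ?_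
  rcases Finset.mem_union.1 (Finset.mem_coe.1 ha) with ha | ha
  · exact covS_of_wbS hbc hA a ha
  · exact covS_of_wbS hbc hB a ha

theorem lawsonCov_inconsistent {b : S} {C : Finset S} (h : cov b ↑C) :
    lawsonCov cov {PatchGen.l C, PatchGen.r b} ∅ := by
  refine GCov_cut (lawsonCov_l_of_covS (A := {b}) (B := C) (by simpa [covS] using h))
    (by simp) ?_
  rintro _ rfl
  exact GCov.le (by grind) (GCov_of_thy (LawsonThy.D b))

/-- The axiom (Loc), for finite subsets. -/
theorem lawsonCov_loc_finset (hbc : IsBasicCover cov) {G : Set S} (F : Finset S)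
    (h : ∀ f ∈ F, ∃ c ∈ G, wb cov f c) :
    lawsonCov cov ∅ ({{PatchGen.l F}} ∪ {B | ∃ c ∈ G, B = {PatchGen.r c}}) := by
  induction F using Finset.induction_on with
  | empty => exact GCov_mono (GCov_of_thy LawsonThy.L1) Set.subset_union_left
  | insert f F _ ih =>
    obtain ⟨c, hc, hfc⟩ := h f (Finset.mem_insert_self f F)
    refine GCov_trans (ih fun g hg => h g (Finset.mem_insert_of_mem hg)) ?_
    rintro B (rfl | hB)
    · refine GCov_cut (GCov_of_thy (LawsonThy.Loc f c hfc)) (Finset.empty_subset _) ?_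
      rintro B (rfl | rfl)
      · refine GCov.le (B := {PatchGen.l {f}, PatchGen.l F}) (by grind)
          (GCov_mono (lawsonCov_l_union hbc {f} F) ?_)
        rw [← Finset.insert_eq]
        exact Set.subset_union_left
      · exact GCov_of_superset (Or.inr ⟨c, hc, rfl⟩) Finset.subset_union_right
    · exact GCov.refl (Or.inr hB)

/-! ### Compactness -/

/-- `GenShrinks h g` : the generator `h` is a shrinking of the generator `g`, namely
`r b` of `r a` for `b ≪ a`, and `l C` of `l A` for `A ≪ C`. -/
inductive GenShrinks (cov : S → Set S → Prop) : PatchGen S → PatchGen S → Prop where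
  | r {a b : S} : wb cov b a → GenShrinks cov (PatchGen.r b) (PatchGen.r a)
  | l {A C : Finset S} : wbS cov ↑A ↑C → GenShrinks cov (PatchGen.l C) (PatchGen.l A)

/-- every generator of `A` has a shrinking in `A'`. -/
def Shrinks (cov : S → Set S → Prop) (A' A : Finset (PatchGen S)) : Prop :=
  ∀ g ∈ A, ∃ h ∈ A', GenShrinks cov h g

theorem GenShrinks.lawsonCov (hbc : IsBasicCover cov) {g h : PatchGen S}
    (hgh : GenShrinks cov h g) : lawsonCov cov {h} {{g}} := by
  cases hgh with
  | r h => exact lawsonCov_r_of_wb hbc h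
  | l h => exact lawsonCov_l_of_covS (covS_of_wbS hbc h)

theorem Shrinks.of_singleton {g h : PatchGen S} (hgh : GenShrinks cov h g) :
    Shrinks cov {h} {g} := by
  simpa [Shrinks] using hgh

theorem Shrinks.mono {A' A B : Finset (PatchGen S)} (h : Shrinks cov A' A) (hB : B ⊆ A) :
    Shrinks cov A' B :=
  fun g hg => h g (hB hg)

theorem Shrinks.union {A' A B' B : Finset (PatchGen S)} (hA : Shrinks cov A' A)
    (hB : Shrinks cov B' B) : Shrinks cov (A' ∪ B') (A ∪ B) := by
  intro g hg
  rcases Finset.mem_union.1 hg with hg | hg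
  · obtain ⟨h, hh, hgh⟩ := hA g hg
    exact ⟨h, Finset.mem_union_left _ hh, hgh⟩
  · obtain ⟨h, hh, hgh⟩ := hB g hg
    exact ⟨h, Finset.mem_union_right _ hh, hgh⟩

theorem Shrinks.exists_r {A' A : Finset (PatchGen S)} {a : S} (h : Shrinks cov A' A)
    (ha : PatchGen.r a ∈ A) : ∃ b, PatchGen.r b ∈ A' ∧ wb cov b a := by
  obtain ⟨_, hb, hba⟩ := h _ ha
  cases hba with
  | r hba => exact ⟨_, hb, hba⟩

theorem Shrinks.exists_l {A' A : Finset (PatchGen S)} {B : Finset S} (h : Shrinks cov A' A)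
    (hB : PatchGen.l B ∈ A) : ∃ C, PatchGen.l C ∈ A' ∧ wbS cov ↑B ↑C := by
  obtain ⟨_, hC, hBC⟩ := h _ hB
  cases hBC with
  | l hBC => exact ⟨_, hC, hBC⟩

theorem Shrinks.lawsonCov (hbc : IsBasicCover cov) {A' A : Finset (PatchGen S)}
    (h : Shrinks cov A' A) : lawsonCov cov A' {A} := by
  induction A using Finset.induction_on with
  | empty => exact GCov_of_superset rfl (Finset.empty_subset _)
  | insert g A _ ih =>
    obtain ⟨k, hk, hkg⟩ := h g (Finset.mem_insert_self g A)
    refine GCov_cut (hkg.lawsonCov hbc) (by simpa using hk) ?_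
    rintro _ rfl
    refine GCov_cut (ih (h.mono (Finset.subset_insert g A))) Finset.subset_union_left ?_
    rintro _ rfl
    exact GCov_of_superset rfl (by grind)

/-- A shrinking of the premise of an axiom is covered by finitely many shrinkings of the
disjuncts of its conclusion. -/
theorem LawsonThy.exists_finset_shrinks (hbc : IsBasicCover cov) {w : S → Set S}
    (hw : IsContinuous cov w) {A A' : Finset (PatchGen S)} {𝒞 : Set (Finset (PatchGen S))}
    (hT : LawsonThy cov A 𝒞) (hA : Shrinks cov A' A) :
    ∃ 𝒟 : Finset (Finset (PatchGen S)), lawsonCov cov A' ↑𝒟 ∧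
      ∀ D ∈ 𝒟, ∃ B ∈ 𝒞, Shrinks cov D B := by
  cases hT with
  | R3 a A h =>
    obtain ⟨b, hb, hba⟩ := hA.exists_r (Finset.mem_singleton_self _)
    obtain ⟨F, hF, hFA⟩ := exists_finset_interpolant hbc hw
      (wbS_of_wbS_of_covS hbc (wbS_singleton hba)
        (show covS cov {a} ↑A by rintro _ rfl; exact h))
    refine ⟨F.image fun f => ({PatchGen.r f} : Finset (PatchGen S)),
      GCov.le (B := {PatchGen.r b}) (by simpa using hb)
      (GCov_mono (lawsonCov_r_of_cov (covS_of_wbS hbc hF b rfl)) ?_), ?_⟩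
    · rintro _ ⟨f, hf, rfl⟩
      simpa using hf
    · simp only [Finset.mem_image]
      rintro _ ⟨f, hf, rfl⟩
      obtain ⟨v, hv, hfv⟩ := hFA f hf
      exact ⟨_, ⟨v, hv, rfl⟩, .of_singleton (.r hfv)⟩
  | R4 a =>
    obtain ⟨b, hb, hba⟩ := hA.exists_r (Finset.mem_singleton_self _)
    obtain ⟨G, hG, hGa⟩ := exists_finset_interpolant hbc hw (wbS_singleton hba)
    obtain ⟨F, hF, hFG⟩ := exists_finset_interpolant hbc hw hG
    refine ⟨F.image fun f => ({PatchGen.r f} : Finset (PatchGen S)),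
      GCov.le (B := {PatchGen.r b}) (by simpa using hb)
      (GCov_mono (lawsonCov_r_of_cov (covS_of_wbS hbc hF b rfl)) ?_), ?_⟩
    · rintro _ ⟨f, hf, rfl⟩
      simpa using hf
    · simp only [Finset.mem_image]
      rintro _ ⟨f, hf, rfl⟩
      obtain ⟨g, hg, hfg⟩ := hFG f hf
      obtain ⟨_, rfl, hga⟩ := hGa g hg
      exact ⟨_, ⟨g, hga, rfl⟩, .of_singleton (.r hfg)⟩
  | L1 =>
    refine ⟨{{PatchGen.l ∅}}, ?_, ?_⟩
    · rw [Finset.coe_singleton]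
      exact GCov.le (Finset.empty_subset A') (GCov_of_thy LawsonThy.L1)
    · simp only [Finset.mem_singleton]
      rintro _ rfl
      exact ⟨_, rfl, .of_singleton (.l (wbS_finset hbc ∅ (by simp)))⟩
  | L2 A B h =>
    obtain ⟨C, hC, hBC⟩ := hA.exists_l (Finset.mem_singleton_self _)
    refine ⟨{{PatchGen.l C}},
      GCov_of_superset (B := {PatchGen.l C}) (by simp) (by simpa using hC), ?_⟩
    simp only [Finset.mem_singleton]
    rintro _ rfl
    exact ⟨_, rfl, .of_singleton (.l (wbS_of_covS_of_wbS hbc h hBC))⟩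
  | L3 A B =>
    obtain ⟨C, hC, hAC⟩ := hA.exists_l (B := A) (by simp)
    obtain ⟨D, hD, hBD⟩ := hA.exists_l (B := B) (by simp)
    obtain ⟨F, hF, hFC⟩ := exists_finset_interpolant hbc hw
      (wbS_of_wbS_of_covS hbc hAC (V' := ↑(C ∪ D)) (covS_of_subset hbc (by simp)))
    obtain ⟨G, hG, hGD⟩ := exists_finset_interpolant hbc hw
      (wbS_of_wbS_of_covS hbc hBD (V' := ↑(C ∪ D)) (covS_of_subset hbc (by simp)))
    refine ⟨{{PatchGen.l (C ∪ D)}}, GCov.le (B := {PatchGen.l C, PatchGen.l D}) (by grind)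
      (by rw [Finset.coe_singleton]; exact lawsonCov_l_union hbc C D), ?_⟩
    simp only [Finset.mem_singleton]
    rintro _ rfl
    refine ⟨_, ⟨F ∪ G, wbS_of_wbS_of_covS hbc hF (covS_of_subset hbc (by simp)),
      wbS_of_wbS_of_covS hbc hG (covS_of_subset hbc (by simp)), rfl⟩,
      .of_singleton (.l (wbS_finset hbc _ fun f hf => ?_))⟩
    rcases Finset.mem_union.1 hf with hf | hf
    · exact hFC f hf
    · exact hGD f hf
  | Loc a b h =>
    obtain ⟨G, hG, hGb⟩ := exists_finset_interpolant hbc hw (wbS_singleton h)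
    obtain ⟨F, hF, hFG⟩ := exists_finset_interpolant hbc hw hG
    refine ⟨insert {PatchGen.l F} (G.image fun g => ({PatchGen.r g} : Finset (PatchGen S))),
      GCov.le (Finset.empty_subset A') (GCov_mono (lawsonCov_loc_finset hbc F hFG) ?_), ?_⟩
    · rintro _ (rfl | ⟨g, hg, rfl⟩)
      · simp
      · simp [Finset.mem_coe.1 hg]
    · simp only [Finset.mem_insert, Finset.mem_image]
      rintro _ (rfl | ⟨g, hg, rfl⟩)
      · exact ⟨_, Or.inl rfl, .of_singleton (.l (by simpa using hF))⟩
      · obtain ⟨_, rfl, hgb⟩ := hGb g hg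
        exact ⟨_, Or.inr rfl, .of_singleton (.r hgb)⟩
  | D a =>
    obtain ⟨C, hC, haC⟩ := hA.exists_l (B := {a}) (by simp)
    obtain ⟨b, hb, hba⟩ := hA.exists_r (a := a) (by simp)
    have hbC : cov b ↑C := hbc.2 _ _ _ (covS_of_wbS hbc (wbS_singleton hba) b rfl)
      (by simpa using covS_of_wbS hbc haC)
    refine ⟨∅, ?_, by simp⟩
    rw [Finset.coe_empty]
    exact GCov.le (B := {PatchGen.l C, PatchGen.r b}) (by grind)
      (lawsonCov_inconsistent hbC)

theorem Shrinks.exists_finite_subcover (hbc : IsBasicCover cov) {w : S → Set S}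
    (hw : IsContinuous cov w) {A A' : Finset (PatchGen S)} {𝒰 : Set (Finset (PatchGen S))}
    (hA : Shrinks cov A' A) (h : FTP.lawsonCov cov A 𝒰) :
    ∃ 𝒰₀ : Finset (Finset (PatchGen S)), ↑𝒰₀ ⊆ 𝒰 ∧ FTP.lawsonCov cov A' ↑𝒰₀ := by
  induction h generalizing A' with
  | @refl A 𝒰 h => exact ⟨{A}, by simpa using h, by simpa using hA.lawsonCov hbc⟩
  | le hBA _ ih => exact ih (hA.mono hBA)
  | ax C hT _ ih =>
    obtain ⟨𝒟, h𝒟, hshr⟩ :=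
      hT.exists_finset_shrinks hbc hw (hA.mono Finset.subset_union_right)
    refine GCov_cut_finset h𝒟 subset_rfl fun D hD => ?_
    obtain ⟨B, hB, hDB⟩ := hshr D hD
    exact ih B hB ((hA.mono Finset.subset_union_left).union hDB)

theorem lawsonCov_compact (hbc : IsBasicCover cov) {w : S → Set S}
    (hw : IsContinuous cov w) : Compact (lawsonCov cov) := by
  intro 𝒲 h𝒲
  obtain ⟨𝒲₀, hsub, hcov⟩ := Shrinks.exists_finite_subcover hbc hw
    (A := ∅) (A' := ∅) (fun g hg => by simp at hg) (h𝒲 ∅ trivial)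
  exact ⟨𝒲₀, hsub, fun A _ => GCov.le (Finset.empty_subset A) hcov⟩

/-! ### Regularity -/

theorem lawsonCov_wc_r (hbc : IsBasicCover cov) {a b : S} (h : wb cov b a) :
    wc (lawsonCov cov) supord {PatchGen.r b} {PatchGen.r a} := by
  refine GCov_wc_of_cover (GCov_of_thy (LawsonThy.Loc b a h)) ?_
  rintro _ (rfl | rfl)
  · exact Or.inl (GCov.le (by grind)
      (lawsonCov_inconsistent (b := b) (C := {b}) (hbc.1 _ _ (by simp))))
  · exact Or.inr (GCov.refl rfl)

theorem lawsonCov_wc_l (hbc : IsBasicCover cov) {w : S → Set S} (hw : IsContinuous cov w)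
    {A C : Finset S} (h : wbS cov ↑A ↑C) :
    wc (lawsonCov cov) supord {PatchGen.l C} {PatchGen.l A} := by
  obtain ⟨F, hF, hFC⟩ := exists_finset_interpolant hbc hw h
  refine GCov_wc_of_cover (lawsonCov_loc_finset hbc F hFC) ?_
  rintro _ (rfl | ⟨c, hc, rfl⟩)
  · exact Or.inr (lawsonCov_l_of_covS (covS_of_wbS hbc hF))
  · exact Or.inl (GCov.le (by grind) (lawsonCov_inconsistent (hbc.1 c ↑C hc)))

theorem lawsonCov_regular (hbc : IsBasicCover cov) {w : S → Set S}
    (hw : IsContinuous cov w) : Regular (lawsonCov cov) supord := by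
  refine GCov_regular fun g => ?_
  cases g with
  | r a =>
    refine GCov_mono (GCov_of_thy (LawsonThy.R4 a)) ?_
    rintro _ ⟨b, hb, rfl⟩
    exact lawsonCov_wc_r hbc hb
  | l A =>
    have hT := GCov_of_thy (LawsonThy.L3 (cov := cov) A A)
    rw [Finset.pair_eq_singleton] at hT
    refine GCov_mono hT ?_
    rintro _ ⟨C, hC, _, rfl⟩
    exact lawsonCov_wc_l hbc hw hC

end Lawson

/-- For every continuous basic cover `S`, the Lawson topology
`L(S)` is a compact regular formal topology. -/
theorem lawson_compact_regular {S : Type u}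
    (cov : S → Set S → Prop) (hbc : IsBasicCover cov)
    (w : S → Set S) (hw : IsContinuous cov w) :
    Compact (lawsonCov cov) ∧ Regular (lawsonCov cov) supord :=
  ⟨lawsonCov_compact hbc hw, lawsonCov_regular hbc hw⟩

end FTP
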